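/- arXiv:1711.00584 — 2 statements merged into one kernel-verified Lean document; each statement's English description precedes it below -/
import Mathlib

section
/- (Theorem 3.1 of the paper, main equation.) Let Γ be smooth symmetric connection coefficients on ℝ⁴, let F : ℝ² → ℝ⁴ be a smooth one-parameter family of curves with parameters (τ,λ), and set p := ∂_λF and X := ∂_τF. Let ι : ℝ² → ℝ⁴ be a smooth one-parameter family of parallel fields, i.e. (∇_λι)^μ = 0 for all (τ,λ) and μ. Then the τ-derivative of ι satisfies the inhomogeneous parallel propagation equation: for all (τ,λ) and every μ ∈ Fin 4, (∇_λ(∇_τι))^μ = −R^μ_{ναβ}(F)·ι^ν·X^α·p^β. -/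
open scoped BigOperators

/-- Points of the spacetime manifold ℝ⁴, in coordinates. -/
abbrev Pt : Type := Fin 4 → ℝ

/-- Connection coefficients `Γ^μ_{αβ}` on ℝ⁴. -/
abbrev Conn : Type := Pt → Fin 4 → Fin 4 → Fin 4 → ℝ

/-- Coordinate partial derivative `∂_α f` of a scalar field on ℝ⁴. -/
noncomputable def pd (f : Pt → ℝ) (α : Fin 4) (x : Pt) : ℝ :=
  fderiv ℝ f x (Pi.single α 1)

/-- Curvature tensor `R^μ_{ναβ} = ∂_αΓ^μ_{βν} − ∂_βΓ^μ_{αν} + Γ^μ_{ακ}Γ^κ_{βν} − Γ^μ_{βκ}Γ^κ_{αν}`. -/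
noncomputable def curv (Γ : Conn) (x : Pt) (μ ν α β : Fin 4) : ℝ :=
  pd (fun y => Γ y μ β ν) α x - pd (fun y => Γ y μ α ν) β x
    + ∑ κ, Γ x μ α κ * Γ x κ β ν - ∑ κ, Γ x μ β κ * Γ x κ α ν

/-- `∂_λ F`, the partial derivative of a two-parameter family `F(τ,λ)` in `λ`. -/
noncomputable def dlam (F : ℝ → ℝ → Pt) : ℝ → ℝ → Pt :=
  fun τ l μ => deriv (fun s => F τ s μ) l

/-- `∂_τ F`, the partial derivative of a two-parameter family `F(τ,λ)` in `τ`. -/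
noncomputable def dtau (F : ℝ → ℝ → Pt) : ℝ → ℝ → Pt :=
  fun τ l μ => deriv (fun s => F s l μ) τ

/-- Covariant `λ`-derivative of a vector field `V(τ,λ)` along `F`:
`(∇_λV)^μ = ∂_λV^μ + Γ^μ_{αβ}(F) ∂_λF^α V^β`. -/
noncomputable def covLam (Γ : Conn) (F V : ℝ → ℝ → Pt) : ℝ → ℝ → Pt :=
  fun τ l μ => deriv (fun s => V τ s μ) l
    + ∑ α, ∑ β, Γ (F τ l) μ α β * dlam F τ l α * V τ l β

/-- Covariant `τ`-derivative of a vector field `V(τ,λ)` along `F`: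
`(∇_τV)^μ = ∂_τV^μ + Γ^μ_{αβ}(F) ∂_τF^α V^β`. -/
noncomputable def covTau (Γ : Conn) (F V : ℝ → ℝ → Pt) : ℝ → ℝ → Pt :=
  fun τ l μ => deriv (fun s => V s l μ) τ
    + ∑ α, ∑ β, Γ (F τ l) μ α β * dtau F τ l α * V τ l β

/-- The connection coefficients are smooth. -/
def SmoothConn (Γ : Conn) : Prop := ∀ μ α β, ContDiff ℝ (⊤ : ℕ∞) fun x => Γ x μ α β

/-- The connection coefficients are symmetric in the lower indices. -/
def SymmConn (Γ : Conn) : Prop := ∀ x μ α β, Γ x μ α β = Γ x μ β α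

/-- A two-parameter family is smooth (jointly, in each component). -/
def SmoothFam (F : ℝ → ℝ → Pt) : Prop := ∀ μ, ContDiff ℝ (⊤ : ℕ∞) fun q : ℝ × ℝ => F q.1 q.2 μ


/-- Chain rule along a curve for a scalar field on ℝ⁴, in terms of coordinate partial derivatives. -/
theorem hasDerivAt_comp_curve {f : Pt → ℝ} {c : ℝ → Pt} {c' : Pt} {s : ℝ}
    (hf : DifferentiableAt ℝ f (c s)) (hc : ∀ γ, HasDerivAt (fun t => c t γ) (c' γ) s) :
    HasDerivAt (fun t => f (c t)) (∑ γ, pd f γ (c s) * c' γ) s := by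
  have hsum : ∑ γ, pd f γ (c s) * c' γ = fderiv ℝ f (c s) c' := by
    conv_rhs => rw [← Finset.univ_sum_single c', map_sum]
    refine Finset.sum_congr rfl fun γ _ => ?_
    have hsingle : (Pi.single γ (c' γ) : Pt) = c' γ • Pi.single γ 1 := by
      rw [← Pi.single_smul, smul_eq_mul, mul_one]
    rw [hsingle, map_smul, pd, smul_eq_mul, mul_comm]
  rw [hsum]
  exact hf.hasFDerivAt.comp_hasDerivAt s (hasDerivAt_pi.2 hc)

theorem SmoothFam.hasDerivAt_lam_fderiv {F : ℝ → ℝ → Pt} (hF : SmoothFam F) (τ l : ℝ) (μ : Fin 4) :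
    HasDerivAt (fun s => F τ s μ) (fderiv ℝ (fun q : ℝ × ℝ => F q.1 q.2 μ) (τ, l) (0, 1)) l := by
  have h := ((hF μ).differentiable (by simp) (τ, l)).hasFDerivAt
  exact h.comp_hasDerivAt (f := fun s : ℝ => (τ, s)) l
    ((hasDerivAt_const l τ).prodMk (hasDerivAt_id l))

theorem SmoothFam.hasDerivAt_tau_fderiv {F : ℝ → ℝ → Pt} (hF : SmoothFam F) (τ l : ℝ) (μ : Fin 4) :
    HasDerivAt (fun s => F s l μ) (fderiv ℝ (fun q : ℝ × ℝ => F q.1 q.2 μ) (τ, l) (1, 0)) τ := by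
  have h := ((hF μ).differentiable (by simp) (τ, l)).hasFDerivAt
  exact h.comp_hasDerivAt (f := fun s : ℝ => (s, l)) τ
    ((hasDerivAt_id τ).prodMk (hasDerivAt_const τ l))

theorem SmoothFam.hasDerivAt_lam {F : ℝ → ℝ → Pt} (hF : SmoothFam F) (τ l : ℝ) (μ : Fin 4) :
    HasDerivAt (fun s => F τ s μ) (dlam F τ l μ) l :=
  (hF.hasDerivAt_lam_fderiv τ l μ).differentiableAt.hasDerivAt

theorem SmoothFam.hasDerivAt_tau {F : ℝ → ℝ → Pt} (hF : SmoothFam F) (τ l : ℝ) (μ : Fin 4) :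
    HasDerivAt (fun s => F s l μ) (dtau F τ l μ) τ :=
  (hF.hasDerivAt_tau_fderiv τ l μ).differentiableAt.hasDerivAt

theorem SmoothFam.dlam {F : ℝ → ℝ → Pt} (hF : SmoothFam F) : SmoothFam (dlam F) := by
  intro μ
  have h : (fun q : ℝ × ℝ => _root_.dlam F q.1 q.2 μ) =
      fun q => fderiv ℝ (fun q : ℝ × ℝ => F q.1 q.2 μ) q (0, 1) :=
    funext fun q => (hF.hasDerivAt_lam_fderiv q.1 q.2 μ).deriv
  rw [h]
  exact ((hF μ).fderiv_right (by simp)).clm_apply contDiff_const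

theorem SmoothFam.dtau {F : ℝ → ℝ → Pt} (hF : SmoothFam F) : SmoothFam (dtau F) := by
  intro μ
  have h : (fun q : ℝ × ℝ => _root_.dtau F q.1 q.2 μ) =
      fun q => fderiv ℝ (fun q : ℝ × ℝ => F q.1 q.2 μ) q (1, 0) :=
    funext fun q => (hF.hasDerivAt_tau_fderiv q.1 q.2 μ).deriv
  rw [h]
  exact ((hF μ).fderiv_right (by simp)).clm_apply contDiff_const

/-- Equality of mixed partial derivatives. -/
theorem SmoothFam.dlam_dtau {F : ℝ → ℝ → Pt} (hF : SmoothFam F) (τ l : ℝ) (μ : Fin 4) :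
    _root_.dlam (_root_.dtau F) τ l μ = _root_.dtau (_root_.dlam F) τ l μ := by
  set G : ℝ × ℝ → ℝ := fun q => F q.1 q.2 μ
  have hG : Differentiable ℝ (fderiv ℝ G) :=
    ((hF μ).fderiv_right (m := (⊤ : ℕ∞)) (by simp)).differentiable (by simp)
  have h1 : (fun q : ℝ × ℝ => _root_.dlam F q.1 q.2 μ) = fun q => fderiv ℝ G q (0, 1) :=
    funext fun q => (hF.hasDerivAt_lam_fderiv q.1 q.2 μ).deriv
  have h2 : (fun q : ℝ × ℝ => _root_.dtau F q.1 q.2 μ) = fun q => fderiv ℝ G q (1, 0) :=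
    funext fun q => (hF.hasDerivAt_tau_fderiv q.1 q.2 μ).deriv
  have hsymm : IsSymmSndFDerivAt ℝ G (τ, l) :=
    (hF μ).contDiffAt.isSymmSndFDerivAt (by simpa using WithTop.coe_le_coe.2 (le_top : (2 : ℕ∞) ≤ ⊤))
  have e1 := (hF.dtau.hasDerivAt_lam_fderiv τ l μ).deriv
  have e2 := (hF.dlam.hasDerivAt_tau_fderiv τ l μ).deriv
  rw [h2, fderiv_clm_apply (hG _) (by fun_prop)] at e1
  rw [h1, fderiv_clm_apply (hG _) (by fun_prop)] at e2
  refine e1.trans (Eq.trans ?_ e2.symm)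
  simpa using hsymm.eq (0, 1) (1, 0)

/-- The Ricci identity along a two-parameter family: `∇_λ∇_τV − ∇_τ∇_λV = −R(X,p)V`. -/
theorem covLam_covTau_sub {Γ : Conn} (hΓ : SmoothConn Γ) {F V : ℝ → ℝ → Pt}
    (hF : SmoothFam F) (hV : SmoothFam V) (τ l : ℝ) (μ : Fin 4) :
    covLam Γ F (covTau Γ F V) τ l μ - covTau Γ F (covLam Γ F V) τ l μ
      = -∑ ν, ∑ α, ∑ β,
          curv Γ (F τ l) μ ν α β * V τ l ν * dtau F τ l α * dlam F τ l β := by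
  have hd (α β) := (hΓ μ α β).differentiable (by simp) (F τ l)
  have hlam : deriv (fun s => covTau Γ F V τ s μ) l = _ :=
    HasDerivAt.deriv ((hV.dtau.hasDerivAt_lam τ l μ).fun_add
      (HasDerivAt.fun_sum (u := Finset.univ) fun α _ =>
        HasDerivAt.fun_sum (u := Finset.univ) fun β _ =>
        ((hasDerivAt_comp_curve (c := fun s => F τ s) (hd α β) (hF.hasDerivAt_lam τ l)).fun_mul
          (hF.dtau.hasDerivAt_lam τ l α)).fun_mul (hV.hasDerivAt_lam τ l β)))
  have htau : deriv (fun s => covLam Γ F V s l μ) τ = _ :=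
    HasDerivAt.deriv ((hV.dlam.hasDerivAt_tau τ l μ).fun_add
      (HasDerivAt.fun_sum (u := Finset.univ) fun α _ =>
        HasDerivAt.fun_sum (u := Finset.univ) fun β _ =>
        ((hasDerivAt_comp_curve (c := fun s => F s l) (hd α β) (hF.hasDerivAt_tau τ l)).fun_mul
          (hF.dlam.hasDerivAt_tau τ l α)).fun_mul (hV.hasDerivAt_tau τ l β)))
  have hVl (κ) : covLam Γ F V τ l κ =
    dlam V τ l κ + ∑ α, ∑ β, Γ (F τ l) κ α β * dlam F τ l α * V τ l β := rfl
  have hVt (κ) : covTau Γ F V τ l κ =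
    dtau V τ l κ + ∑ α, ∑ β, Γ (F τ l) κ α β * dtau F τ l α * V τ l β := rfl
  rw [covLam, covTau, hlam, htau]
  simp only [hVl, hVt, hV.dlam_dtau, hF.dlam_dtau, curv]
  generalize dlam F τ l = p, dtau F τ l = X, dlam V τ l = Vl, dtau V τ l = Vt, V τ l = W,
    dtau (dlam F) τ l = D, Γ (F τ l) = G
  generalize hP : (fun α β γ => pd (fun x => Γ x μ α β) γ (F τ l)) = P
  have hP' (α β γ) : pd (fun x => Γ x μ α β) γ (F τ l) = P α β γ := by rw [← hP]
  have hPX : ∑ α, ∑ β, (∑ γ, P α β γ * p γ) * X α * W β =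
      ∑ ν, ∑ α, ∑ β, P α ν β * W ν * X α * p β := by
    rw [Finset.sum_comm]
    simp only [Finset.sum_mul]
    refine Finset.sum_congr rfl fun ν _ => Finset.sum_congr rfl fun α _ =>
      Finset.sum_congr rfl fun β _ => by ring
  have hPp : ∑ α, ∑ β, (∑ γ, P α β γ * X γ) * p α * W β =
      ∑ ν, ∑ α, ∑ β, P β ν α * W ν * X α * p β := by
    rw [Finset.sum_comm]
    simp only [Finset.sum_mul]
    refine Finset.sum_congr rfl fun ν _ => ?_
    rw [Finset.sum_comm]
    refine Finset.sum_congr rfl fun α _ => Finset.sum_congr rfl fun β _ => by ring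
  have hGG (u v : Pt) : ∑ α, ∑ β, G μ α β * u α * ∑ a, ∑ b, G β a b * v a * W b =
      ∑ ν, ∑ α, ∑ β, (∑ κ, G μ β κ * G κ α ν) * W ν * v α * u β := by
    calc _ = ∑ β, ∑ κ, ∑ ν, ∑ α, G μ β κ * G κ α ν * W ν * v α * u β := by
          simp only [Finset.mul_sum]
          refine Finset.sum_congr rfl fun β _ => Finset.sum_congr rfl fun κ _ => ?_
          rw [Finset.sum_comm]
          refine Finset.sum_congr rfl fun ν _ => Finset.sum_congr rfl fun α _ => by ring
      _ = ∑ β, ∑ ν, ∑ α, ∑ κ, G μ β κ * G κ α ν * W ν * v α * u β := by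
          refine Finset.sum_congr rfl fun β _ => ?_
          rw [Finset.sum_comm]
          exact Finset.sum_congr rfl fun ν _ => Finset.sum_comm
      _ = _ := by
          simp only [Finset.sum_mul]
          rw [Finset.sum_comm]
          exact Finset.sum_congr rfl fun ν _ => Finset.sum_comm
  have hGX : ∑ ν, ∑ α, ∑ β, (∑ κ, G μ β κ * G κ α ν) * W ν * p α * X β =
      ∑ ν, ∑ α, ∑ β, (∑ κ, G μ α κ * G κ β ν) * W ν * X α * p β := by
    refine Finset.sum_congr rfl fun ν _ => ?_
    rw [Finset.sum_comm]
    refine Finset.sum_congr rfl fun α _ => Finset.sum_congr rfl fun β _ => by ring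
  simp only [hP', add_mul, sub_mul, mul_add, Finset.sum_add_distrib, Finset.sum_sub_distrib,
    hPX, hPp, hGG, hGX]
  ring

/-- Theorem 3.1 of the paper, main equation: if `ι(τ,λ)` is a smooth
one-parameter family of parallel fields along a smooth family of curves `F(τ,λ)`
(`(∇_λι)^μ = 0`), then with `p = ∂_λF` and `X = ∂_τF` the `τ`-derivative of `ι`
satisfies the inhomogeneous parallel propagation equation
`(∇_λ(∇_τι))^μ = −R^μ_{ναβ}(F) ι^ν X^α p^β`. -/
theorem parallel_transport_drift
    (Γ : Conn) (hΓs : SmoothConn Γ) (hΓsym : SymmConn Γ)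
    (F : ℝ → ℝ → Pt) (hF : SmoothFam F)
    (ι : ℝ → ℝ → Pt) (hι : SmoothFam ι)
    (hpar : ∀ τ l μ, covLam Γ F ι τ l μ = 0) :
    ∀ τ l μ,
      covLam Γ F (covTau Γ F ι) τ l μ
        = -∑ ν, ∑ α, ∑ β,
            curv Γ (F τ l) μ ν α β * ι τ l ν * dtau F τ l α * dlam F τ l β := by
  intro τ l μ
  have hzero : covLam Γ F ι = 0 := by
    funext τ l μ
    exact hpar τ l μ
  have hcov : covTau Γ F 0 τ l μ = 0 := by simp [covTau]
  rw [← covLam_covTau_sub hΓs hF hι τ l μ, hzero, hcov, sub_zero]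
end

section
/- Let u ∈ ℝ⁴ with η(u,u) = −1 and let p ∈ ℝ⁴ be nonzero and null (η(p,p) = 0); set Q := η(p,u) and r := p/Q + u, so that η(r,r) = 1, η(r,u) = 0. For vectors l ∈ ℝ⁴ with η(l,u) ≠ 0 define the sky direction map W(l) := (l + η(l,u)·u)/η(l,u), so that W(p) = r. Then for every δp ∈ ℝ⁴ with η(δp, p) = 0, the map ε ↦ W(p + ε·δp) is differentiable at ε = 0 with derivative (δp + η(δp,u)·u − η(δp,r)·r)/η(p,u); i.e. the linearization of the direction map at p, restricted to null-preserving perturbations, is the orthogonal projection onto the screen space (orthogonal to both u and r) divided by η(p,u). -/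
/-- The Minkowski bilinear form on ℝ⁴: `η(x,y) = −x₀y₀ + x₁y₁ + x₂y₂ + x₃y₃`. -/
def eta (x y : Fin 4 → ℝ) : ℝ :=
  -(x 0 * y 0) + x 1 * y 1 + x 2 * y 2 + x 3 * y 3

/-- The sky direction map of the observer `u`:
`W(l) = (l + η(l,u)·u)/η(l,u)`. -/
noncomputable def skyW (u l : Fin 4 → ℝ) : Fin 4 → ℝ :=
  (eta l u)⁻¹ • (l + eta l u • u)

/-- The direction of observation `r = p/Q + u` with `Q = η(p,u)`. -/
noncomputable def rDir (u p : Fin 4 → ℝ) : Fin 4 → ℝ :=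
  (eta p u)⁻¹ • p + u

theorem eta_add_left (x y z : Fin 4 → ℝ) : eta (x + y) z = eta x z + eta y z := by
  simp only [eta, Pi.add_apply]; ring

theorem eta_smul_left (c : ℝ) (x y : Fin 4 → ℝ) : eta (c • x) y = c * eta x y := by
  simp only [eta, Pi.smul_apply, smul_eq_mul]; ring

theorem eta_comm (x y : Fin 4 → ℝ) : eta x y = eta y x := by
  simp only [eta]; ring

/-- A nonzero null vector is never orthogonal to a unit timelike vector. -/
theorem eta_ne_zero_of_null {u p : Fin 4 → ℝ} (hu : eta u u = -1) (hp : p ≠ 0)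
    (hnull : eta p p = 0) : eta p u ≠ 0 := by
  intro h
  apply hp
  simp only [eta] at hu hnull h
  have hcs : (p 1 * u 1 + p 2 * u 2 + p 3 * u 3) ^ 2 ≤
      (p 1 ^ 2 + p 2 ^ 2 + p 3 ^ 2) * (u 1 ^ 2 + u 2 ^ 2 + u 3 ^ 2) := by
    nlinarith [sq_nonneg (p 1 * u 2 - p 2 * u 1), sq_nonneg (p 1 * u 3 - p 3 * u 1),
      sq_nonneg (p 2 * u 3 - p 3 * u 2)]
  rw [show p 1 * u 1 + p 2 * u 2 + p 3 * u 3 = p 0 * u 0 by linarith,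
    show p 1 ^ 2 + p 2 ^ 2 + p 3 ^ 2 = p 0 ^ 2 by linarith,
    show u 1 ^ 2 + u 2 ^ 2 + u 3 ^ 2 = u 0 ^ 2 - 1 by linarith] at hcs
  have h0 : p 0 = 0 := by
    apply pow_eq_zero_iff two_ne_zero |>.mp
    nlinarith [sq_nonneg (p 0)]
  rw [h0] at hnull
  have h1 : p 1 = 0 := by nlinarith [sq_nonneg (p 1), sq_nonneg (p 2), sq_nonneg (p 3)]
  have h2 : p 2 = 0 := by nlinarith [sq_nonneg (p 1), sq_nonneg (p 2), sq_nonneg (p 3)]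
  have h3 : p 3 = 0 := by nlinarith [sq_nonneg (p 1), sq_nonneg (p 2), sq_nonneg (p 3)]
  ext i
  fin_cases i <;> assumption

/-- for a normalized observer `u` (`η(u,u) = −1`) and a nonzero null
vector `p`, the vector `r = p/η(p,u) + u` satisfies `η(r,r) = 1`, `η(r,u) = 0` and
`W(p) = r`; and for every perturbation `δp` with `η(δp,p) = 0` the map
`ε ↦ W(p + ε·δp)` is differentiable at `ε = 0` with derivative
`(δp + η(δp,u)·u − η(δp,r)·r)/η(p,u)`: the linearization of the direction map on
null-preserving perturbations is the screen-space projection divided by `η(p,u)`. -/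
theorem sky_direction_map_linearization
    (u p : Fin 4 → ℝ) (hu : eta u u = -1) (hp : p ≠ 0) (hnull : eta p p = 0) :
    (eta (rDir u p) (rDir u p) = 1 ∧ eta (rDir u p) u = 0 ∧ skyW u p = rDir u p) ∧
    ∀ δp : Fin 4 → ℝ, eta δp p = 0 →
      HasDerivAt (fun ε : ℝ => skyW u (p + ε • δp))
        ((eta p u)⁻¹ •
          (δp + eta δp u • u - eta δp (rDir u p) • rDir u p)) 0 := by
  have hQ : eta p u ≠ 0 := eta_ne_zero_of_null hu hp hnull
  have hr (x : Fin 4 → ℝ) : eta x (rDir u p) = (eta p u)⁻¹ * eta x p + eta x u := by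
    rw [eta_comm x, rDir, eta_add_left, eta_smul_left, eta_comm p x, eta_comm u x]
  have hru : eta (rDir u p) u = 0 := by
    rw [rDir, eta_add_left, eta_smul_left, hu, inv_mul_cancel₀ hQ]
    ring
  refine ⟨⟨?_, hru, ?_⟩, fun δp hδ => ?_⟩
  · rw [hr, hru, eta_comm (rDir u p), hr, hnull, mul_zero, zero_add, inv_mul_cancel₀ hQ, add_zero]
  · rw [skyW, rDir, smul_add, smul_smul, inv_mul_cancel₀ hQ, one_smul]
  · have hl : HasDerivAt (fun ε : ℝ => p + ε • δp) δp 0 := by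
      simpa using ((hasDerivAt_id (0 : ℝ)).smul_const δp).const_add p
    have hc : HasDerivAt (fun ε : ℝ => eta (p + ε • δp) u) (eta δp u) 0 := by
      simp only [eta_add_left, eta_smul_left]
      simpa using ((hasDerivAt_id (0 : ℝ)).mul_const (eta δp u)).const_add (eta p u)
    have hW := (hc.fun_inv (by simpa using hQ)).fun_smul (hl.fun_add (hc.smul_const u))
    unfold skyW
    refine hW.congr_deriv ?_
    rw [hr, hδ, rDir]
    ext i
    simp only [zero_smul, add_zero, Pi.add_apply, Pi.sub_apply, Pi.smul_apply, smul_eq_mul]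
    field_simp
    ring
end
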